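/- Uniqueness of inferred types in the cumulative bidirectional system: if ⊢ Γ, Γ ⊢ t ▹ T and Γ ⊢ t ▹ T', then T ≡ T'. -/

import Mathlib

/-! Formalization of CCω (terms, reduction, conversion, undirected and
bidirectional typing, cumulativity) using de Bruijn indices, following
Lennon-Bertrand, "Complete Bidirectional Typing for the Calculus of
Inductive Constructions". -/

namespace CComega

/-- Terms of CCω: `t ::= x | □_i | Πx:t.t | λx:t.t | t t`,
with variables as de Bruijn indices. -/
inductive Tm : Type
  | var : ℕ → Tm
  | sort : ℕ → Tm
  | pi : Tm → Tm → Tm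
  | lam : Tm → Tm → Tm
  | app : Tm → Tm → Tm
deriving DecidableEq

/-- `lift n k t` shifts by `n` the de Bruijn indices of `t` that are ≥ `k`. -/
def lift (n k : ℕ) : Tm → Tm
  | .var i => if i < k then .var i else .var (i + n)
  | .sort i => .sort i
  | .pi A B => .pi (lift n k A) (lift n (k + 1) B)
  | .lam A t => .lam (lift n k A) (lift n (k + 1) t)
  | .app t u => .app (lift n k t) (lift n k u)

/-- `subst u k t` is the capture-avoiding substitution `t[u/k]` of `u`
for de Bruijn index `k` in `t`. -/
def subst (u : Tm) (k : ℕ) : Tm → Tm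
  | .var i => if i < k then .var i else if i = k then lift k 0 u else .var (i - 1)
  | .sort i => .sort i
  | .pi A B => .pi (subst u k A) (subst u (k + 1) B)
  | .lam A t => .lam (subst u k A) (subst u (k + 1) t)
  | .app t v => .app (subst u k t) (subst u k v)

/-- One-step reduction `t → t'`: the least congruence such that
`(λx:A.t) u → t[u/x]`. -/
inductive Red : Tm → Tm → Prop
  | beta (A t u : Tm) : Red (.app (.lam A t) u) (subst u 0 t)
  | piDom {A A'} (B : Tm) : Red A A' → Red (.pi A B) (.pi A' B)
  | piCod (A : Tm) {B B'} : Red B B' → Red (.pi A B) (.pi A B')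
  | lamDom {A A'} (t : Tm) : Red A A' → Red (.lam A t) (.lam A' t)
  | lamBody (A : Tm) {t t'} : Red t t' → Red (.lam A t) (.lam A t')
  | appFun {t t'} (u : Tm) : Red t t' → Red (.app t u) (.app t' u)
  | appArg (t : Tm) {u u'} : Red u u' → Red (.app t u) (.app t u')

/-- Multi-step reduction `t ↠ t'`: reflexive-transitive closure of `→`. -/
def Reds : Tm → Tm → Prop := Relation.ReflTransGen Red

/-- Conversion `t ≡ u`: symmetric, reflexive, transitive closure of `→`. -/
def Conv : Tm → Tm → Prop := Relation.EqvGen Red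

/-- Contexts are lists of (de Bruijn) declarations, most recent first. -/
abbrev Ctx := List Tm

mutual
/-- Context well-formedness `⊢ Γ`. -/
inductive WfCtx : Ctx → Prop
  | nil : WfCtx []
  | cons {Γ A i} : WfCtx Γ → Typed Γ A (.sort i) → WfCtx (A :: Γ)

/-- Undirected typing `Γ ⊢ t : T`. -/
inductive Typed : Ctx → Tm → Tm → Prop
  | sort {Γ i} : WfCtx Γ → Typed Γ (.sort i) (.sort (i + 1))
  | var {Γ n A} : WfCtx Γ → Γ[n]? = some A → Typed Γ (.var n) (lift (n + 1) 0 A)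
  | pi {Γ A B i j} : Typed Γ A (.sort i) → Typed (A :: Γ) B (.sort j) →
      Typed Γ (.pi A B) (.sort (max i j))
  | lam {Γ A B t i} : Typed Γ (.pi A B) (.sort i) → Typed (A :: Γ) t B →
      Typed Γ (.lam A t) (.pi A B)
  | app {Γ t u A B} : Typed Γ t (.pi A B) → Typed Γ u A →
      Typed Γ (.app t u) (subst u 0 B)
  | conv {Γ t A B i} : Typed Γ t A → Typed Γ B (.sort i) → Conv A B →
      Typed Γ t B
end

mutual
/-- Bidirectional inference `Γ ⊢ t ▹ T`. -/
inductive Infer : Ctx → Tm → Tm → Prop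
  | sort {Γ i} : Infer Γ (.sort i) (.sort (i + 1))
  | var {Γ n A} : Γ[n]? = some A → Infer Γ (.var n) (lift (n + 1) 0 A)
  | pi {Γ A B i j} : InferSort Γ A (.sort i) → InferSort (A :: Γ) B (.sort j) →
      Infer Γ (.pi A B) (.sort (max i j))
  | lam {Γ A t B i} : InferSort Γ A (.sort i) → Infer (A :: Γ) t B →
      Infer Γ (.lam A t) (.pi A B)
  | app {Γ t u A B} : InferPi Γ t (.pi A B) → Check Γ u A →
      Infer Γ (.app t u) (subst u 0 B)

/-- Bidirectional checking `Γ ⊢ t ◃ T`. -/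
inductive Check : Ctx → Tm → Tm → Prop
  | check {Γ t T T'} : Infer Γ t T' → Conv T' T → Check Γ t T

/-- Constrained inference `Γ ⊢ t ▹_□ T` (the output is a universe). -/
inductive InferSort : Ctx → Tm → Tm → Prop
  | inferSort {Γ t T i} : Infer Γ t T → Reds T (.sort i) → InferSort Γ t (.sort i)

/-- Constrained inference `Γ ⊢ t ▹_Π T` (the output is a product type). -/
inductive InferPi : Ctx → Tm → Tm → Prop
  | inferPi {Γ t T A B} : Infer Γ t T → Reds T (.pi A B) → InferPi Γ t (.pi A B)
end

/-- Weak-head reduction `t ⇝ t'`: reduction only at the head. -/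
inductive WhRed : Tm → Tm → Prop
  | beta (A t u : Tm) : WhRed (.app (.lam A t) u) (subst u 0 t)
  | appFun {t t'} (u : Tm) : WhRed t t' → WhRed (.app t u) (.app t' u)

/-- Multi-step weak-head reduction `t ⇝* t'`. -/
def WhReds : Tm → Tm → Prop := Relation.ReflTransGen WhRed

mutual
/-- Weak-head bidirectional inference: as `Infer`, but constrained inference
uses weak-head reduction. -/
inductive InferW : Ctx → Tm → Tm → Prop
  | sort {Γ i} : InferW Γ (.sort i) (.sort (i + 1))
  | var {Γ n A} : Γ[n]? = some A → InferW Γ (.var n) (lift (n + 1) 0 A)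
  | pi {Γ A B i j} : InferSortW Γ A (.sort i) → InferSortW (A :: Γ) B (.sort j) →
      InferW Γ (.pi A B) (.sort (max i j))
  | lam {Γ A t B i} : InferSortW Γ A (.sort i) → InferW (A :: Γ) t B →
      InferW Γ (.lam A t) (.pi A B)
  | app {Γ t u A B} : InferPiW Γ t (.pi A B) → CheckW Γ u A →
      InferW Γ (.app t u) (subst u 0 B)

/-- Weak-head bidirectional checking. -/
inductive CheckW : Ctx → Tm → Tm → Prop
  | check {Γ t T T'} : InferW Γ t T' → Conv T' T → CheckW Γ t T

/-- Weak-head constrained inference `Γ ⊢ t ▹_□ T`. -/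
inductive InferSortW : Ctx → Tm → Tm → Prop
  | inferSort {Γ t T i} : InferW Γ t T → WhReds T (.sort i) →
      InferSortW Γ t (.sort i)

/-- Weak-head constrained inference `Γ ⊢ t ▹_Π T`. -/
inductive InferPiW : Ctx → Tm → Tm → Prop
  | inferPi {Γ t T A B} : InferW Γ t T → WhReds T (.pi A B) →
      InferPiW Γ t (.pi A B)
end

/-- Cumulativity `t ≼ u`: the least transitive relation containing conversion
such that `□_i ≼ □_j` whenever `i ≤ j` and `Πx:A.B ≼ Πx:A'.B'` whenever
`A ≡ A'` and `B ≼ B'`. -/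
inductive Cum : Tm → Tm → Prop
  | ofConv {t u} : Conv t u → Cum t u
  | sort {i j : ℕ} : i ≤ j → Cum (.sort i) (.sort j)
  | pi {A A' B B'} : Conv A A' → Cum B B' → Cum (.pi A B) (.pi A' B')
  | trans {t u v} : Cum t u → Cum u v → Cum t v

mutual
/-- Context well-formedness for the cumulative undirected system. -/
inductive WfCtxC : Ctx → Prop
  | nil : WfCtxC []
  | cons {Γ A i} : WfCtxC Γ → TypedC Γ A (.sort i) → WfCtxC (A :: Γ)

/-- Cumulative undirected typing `Γ ⊢ t : T`: as `Typed`, with the conversion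
rule replaced by cumulativity. -/
inductive TypedC : Ctx → Tm → Tm → Prop
  | sort {Γ i} : WfCtxC Γ → TypedC Γ (.sort i) (.sort (i + 1))
  | var {Γ n A} : WfCtxC Γ → Γ[n]? = some A → TypedC Γ (.var n) (lift (n + 1) 0 A)
  | pi {Γ A B i j} : TypedC Γ A (.sort i) → TypedC (A :: Γ) B (.sort j) →
      TypedC Γ (.pi A B) (.sort (max i j))
  | lam {Γ A B t i} : TypedC Γ (.pi A B) (.sort i) → TypedC (A :: Γ) t B →
      TypedC Γ (.lam A t) (.pi A B)
  | app {Γ t u A B} : TypedC Γ t (.pi A B) → TypedC Γ u A →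
      TypedC Γ (.app t u) (subst u 0 B)
  | cumul {Γ t A B i} : TypedC Γ t A → TypedC Γ B (.sort i) → Cum A B →
      TypedC Γ t B
end

mutual
/-- Cumulative bidirectional inference `Γ ⊢ t ▹ T`. -/
inductive InferC : Ctx → Tm → Tm → Prop
  | sort {Γ i} : InferC Γ (.sort i) (.sort (i + 1))
  | var {Γ n A} : Γ[n]? = some A → InferC Γ (.var n) (lift (n + 1) 0 A)
  | pi {Γ A B i j} : InferSortC Γ A (.sort i) → InferSortC (A :: Γ) B (.sort j) →
      InferC Γ (.pi A B) (.sort (max i j))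
  | lam {Γ A t B i} : InferSortC Γ A (.sort i) → InferC (A :: Γ) t B →
      InferC Γ (.lam A t) (.pi A B)
  | app {Γ t u A B} : InferPiC Γ t (.pi A B) → CheckC Γ u A →
      InferC Γ (.app t u) (subst u 0 B)

/-- Cumulative bidirectional checking `Γ ⊢ t ◃ T`, using cumulativity. -/
inductive CheckC : Ctx → Tm → Tm → Prop
  | check {Γ t T T'} : InferC Γ t T' → Cum T' T → CheckC Γ t T

/-- Cumulative constrained inference `Γ ⊢ t ▹_□ T` (unchanged: uses reduction). -/
inductive InferSortC : Ctx → Tm → Tm → Prop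
  | inferSort {Γ t T i} : InferC Γ t T → Reds T (.sort i) → InferSortC Γ t (.sort i)

/-- Cumulative constrained inference `Γ ⊢ t ▹_Π T` (unchanged: uses reduction). -/
inductive InferPiC : Ctx → Tm → Tm → Prop
  | inferPi {Γ t T A B} : InferC Γ t T → Reds T (.pi A B) → InferPiC Γ t (.pi A B)
end

theorem lift_lift_merge (p n : ℕ) (M : Tm) : ∀ {i k : ℕ}, k ≤ i → i ≤ k + n →
    lift p i (lift n k M) = lift (p + n) k M := by
  induction M with
  | var => intros; simp only [lift]; split_ifs <;> simp only [lift] <;> grind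
  | sort => intros; rfl
  | _ => intros; simp only [lift]; congr 1 <;> grind

theorem lift_lift_comm (p n : ℕ) (M : Tm) : ∀ {i k : ℕ}, i ≤ k →
    lift p i (lift n k M) = lift n (p + k) (lift p i M) := by
  induction M with
  | var => intros; simp only [lift]; split_ifs <;> simp only [lift] <;> grind
  | sort => intros; rfl
  | _ => intros; simp only [lift]; congr 1 <;> grind

theorem subst_lift_cancel (N : Tm) (n : ℕ) (M : Tm) : ∀ {p k : ℕ}, k ≤ p → p ≤ n + k →
    subst N p (lift (n + 1) k M) = lift n k M := by
  induction M with
  | var => intros; simp only [lift]; split_ifs <;> (try simp only [subst]) <;> grind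
  | sort => intros; rfl
  | _ => intros; simp only [lift, subst]; congr 1 <;> grind

theorem lift_subst_comm (N : Tm) (n : ℕ) (M : Tm) : ∀ {p k : ℕ}, k ≤ p →
    lift n k (subst N p M) = subst N (n + p) (lift n k M) := by
  induction M with
  | var x =>
    intro p k hk
    rcases lt_trichotomy x p with h | rfl | h
    · simp only [lift, subst]; split_ifs <;> simp only [lift, subst] <;> grind
    · have := lift_lift_merge n x N (i := k) (k := 0) (by omega) (by omega)
      simp only [lift, subst]; split_ifs <;> (try simp only [subst]) <;> grind
    · simp only [lift, subst]; split_ifs <;> simp only [lift, subst] <;> grind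
  | sort => intros; rfl
  | _ => intros; simp only [lift, subst]; congr 1 <;> grind

theorem lift_subst_distrib (N : Tm) (n k : ℕ) (M : Tm) : ∀ p : ℕ,
    lift n (p + k) (subst N p M) = subst (lift n k N) p (lift n (p + k + 1) M) := by
  induction M with
  | var x =>
    intro p
    rcases lt_trichotomy x p with h | rfl | h
    · simp only [lift, subst]; split_ifs <;> simp only [lift, subst] <;> grind
    · have := lift_lift_comm x n N (i := 0) (k := k) (by omega)
      simp only [lift, subst]; split_ifs <;> (try simp only [subst]) <;> grind
    · simp only [lift, subst]; split_ifs <;> simp only [lift, subst] <;> grind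
  | sort => intros; rfl
  | _ => intros; simp only [lift, subst]; congr 1 <;> grind

theorem subst_subst_distrib (P N : Tm) (n : ℕ) (M : Tm) : ∀ p : ℕ,
    subst P (p + n) (subst N p M) = subst (subst P n N) p (subst P (p + n + 1) M) := by
  induction M with
  | var x =>
    intro p
    rcases lt_trichotomy x p with h | rfl | h
    · simp only [subst]; split_ifs <;> (try simp only [subst]) <;> grind
    · have := lift_subst_comm P x N (p := n) (k := 0) (by omega)
      simp only [subst]; split_ifs <;> (try simp only [subst]) <;> grind
    · rcases eq_or_ne x (p + n + 1) with rfl | hne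
      · have := subst_lift_cancel (subst P n N) (p + n) P (p := p) (k := 0) (by omega) (by omega)
        simp only [subst]; split_ifs <;> (try simp only [subst]) <;> grind
      · simp only [subst]; split_ifs <;> (try simp only [subst]) <;> grind
  | sort => intros; rfl
  | _ => intros; simp only [subst]; congr 1 <;> grind

/-- Parallel reduction. -/
inductive Par : Tm → Tm → Prop
  | var (i : ℕ) : Par (.var i) (.var i)
  | sort (i : ℕ) : Par (.sort i) (.sort i)
  | pi {A A' B B'} : Par A A' → Par B B' → Par (.pi A B) (.pi A' B')
  | lam {A A' t t'} : Par A A' → Par t t' → Par (.lam A t) (.lam A' t')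
  | app {t t' u u'} : Par t t' → Par u u' → Par (.app t u) (.app t' u')
  | beta (A) {t t' u u'} : Par t t' → Par u u' → Par (.app (.lam A t) u) (subst u' 0 t')

theorem Par.refl (t : Tm) : Par t t := by
  induction t <;> constructor <;> assumption

theorem Par.of_red {t t' : Tm} (h : Red t t') : Par t t' := by
  induction h with
  | beta => exact .beta _ (.refl _) (.refl _)
  | _ => constructor <;> first | assumption | exact .refl _

theorem Par.lift (n : ℕ) {t t' : Tm} (h : Par t t') (k : ℕ) :
    Par (lift n k t) (lift n k t') := by
  induction h generalizing k with
  | var | sort => exact .refl _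
  | beta A _ _ iht ihu =>
    have e := fun N M => lift_subst_distrib N n k M 0
    simp only [Nat.zero_add] at e
    rw [e]
    exact Par.beta (CComega.lift n k A) (iht (k + 1)) (ihu k)
  | _ => constructor <;> grind

theorem Par.subst {t t' u u' : Tm} (h : Par t t') (hu : Par u u') (k : ℕ) :
    Par (subst u k t) (subst u' k t') := by
  induction h generalizing k with
  | var i =>
    simp only [CComega.subst]
    split_ifs
    · exact .refl _
    · exact hu.lift _ _
    · exact .refl _
  | sort => exact .refl _
  | beta A _ _ iht ihu =>
    have e := fun N M => subst_subst_distrib u' N k M 0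
    simp only [Nat.zero_add] at e
    rw [e]
    exact Par.beta (CComega.subst u k A) (iht (k + 1)) (ihu k)
  | _ => constructor <;> grind

/-- Complete development: contracts all redexes of a term simultaneously. -/
def development : Tm → Tm
  | .var i => .var i
  | .sort i => .sort i
  | .pi A B => .pi (development A) (development B)
  | .lam A t => .lam (development A) (development t)
  | .app (.lam _ t) u => subst (development u) 0 (development t)
  | .app t u => .app (development t) (development u)

theorem Par.development {t t' : Tm} (h : Par t t') : Par t' (development t) := by
  induction h with
  | var | sort => exact .refl _
  | pi _ _ ihA ihB => exact .pi ihA ihB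
  | lam _ _ ihA iht => exact .lam ihA iht
  | beta A _ _ iht ihu => exact iht.subst ihu 0
  | @app t t' u u' ht _ iht ihu =>
    cases t with
    | lam A t =>
      cases ht with
      | lam =>
        cases iht with
        | lam _ ht' => exact .beta _ ht' ihu
    | _ => exact .app iht ihu

theorem Reds.map {f : Tm → Tm} (hf : ∀ {a b}, Red a b → Red (f a) (f b)) {a b : Tm}
    (h : Reds a b) : Reds (f a) (f b) :=
  Relation.ReflTransGen.lift f (fun _ _ => hf) _ _ h

theorem Par.reds {t t' : Tm} (h : Par t t') : Reds t t' := by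
  induction h with
  | var | sort => exact .refl
  | pi _ _ ihA ihB => exact (ihA.map (.piDom _)).trans (ihB.map (.piCod _))
  | lam _ _ ihA iht => exact (ihA.map (.lamDom _)).trans (iht.map (.lamBody _))
  | app _ _ iht ihu => exact (iht.map (.appFun _)).trans (ihu.map (.appArg _))
  | beta A _ _ iht ihu =>
    exact ((iht.map fun h => .appFun _ (.lamBody A h)).trans (ihu.map (.appArg _))).tail
      (.beta _ _ _)

theorem reflTransGen_par_iff {t t' : Tm} : Relation.ReflTransGen Par t t' ↔ Reds t t' := by
  refine ⟨fun h => ?_, fun h => Relation.ReflTransGen.mono (fun _ _ => Par.of_red) _ _ h⟩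
  induction h with
  | refl => exact .refl
  | tail _ h ih => exact ih.trans h.reds

theorem Reds.confluent {a b c : Tm} (hb : Reds a b) (hc : Reds a c) :
    ∃ d, Reds b d ∧ Reds c d := by
  simp only [← reflTransGen_par_iff] at *
  exact Relation.church_rosser
    (fun a _ _ hb hc => ⟨development a, .single hb.development, .single hc.development⟩) hb hc

theorem Conv.refl (t : Tm) : Conv t t := Relation.EqvGen.refl t

theorem Conv.symm {t u : Tm} (h : Conv t u) : Conv u t := Relation.EqvGen.symm _ _ h

theorem Conv.trans {t u v : Tm} (h : Conv t u) (h' : Conv u v) : Conv t v :=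
  Relation.EqvGen.trans _ _ _ h h'

theorem Reds.conv {t u : Tm} (h : Reds t u) : Conv t u := by
  induction h with
  | refl => exact .refl _
  | tail _ h ih => exact ih.trans (.rel _ _ h)

/-- **Church–Rosser**: convertible terms have a common reduct. -/
theorem Conv.join {t u : Tm} (h : Conv t u) : ∃ v, Reds t v ∧ Reds u v := by
  induction h with
  | rel _ _ h => exact ⟨_, .single h, .refl⟩
  | refl => exact ⟨_, .refl, .refl⟩
  | symm _ _ _ ih => obtain ⟨v, h, h'⟩ := ih; exact ⟨v, h', h⟩
  | trans _ _ _ _ _ ih ih' =>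
    obtain ⟨v, h₁, h₂⟩ := ih
    obtain ⟨w, h₃, h₄⟩ := ih'
    obtain ⟨x, h₅, h₆⟩ := h₂.confluent h₃
    exact ⟨x, h₁.trans h₅, h₄.trans h₆⟩

theorem Reds.eq_of_sort {i : ℕ} {t : Tm} (h : Reds (.sort i) t) : t = .sort i := by
  induction h with
  | refl => rfl
  | tail _ h ih => subst ih; cases h

theorem Reds.pi_inv {A B t : Tm} (h : Reds (.pi A B) t) :
    ∃ A' B', t = .pi A' B' ∧ Reds A A' ∧ Reds B B' := by
  induction h with
  | refl => exact ⟨A, B, rfl, .refl, .refl⟩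
  | tail _ h ih =>
    obtain ⟨A', B', rfl, hA, hB⟩ := ih
    cases h with
    | piDom _ h => exact ⟨_, _, rfl, hA.tail h, hB⟩
    | piCod _ h => exact ⟨_, _, rfl, hA, hB.tail h⟩

theorem Conv.sort_inj {i j : ℕ} (h : Conv (.sort i) (.sort j)) : i = j := by
  obtain ⟨v, hi, hj⟩ := h.join
  simpa using hi.eq_of_sort.symm.trans hj.eq_of_sort

theorem Conv.pi_cod {A A' B B' : Tm} (h : Conv (.pi A B) (.pi A' B')) : Conv B B' := by
  obtain ⟨v, h₁, h₂⟩ := h.join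
  obtain ⟨_, _, rfl, -, hB⟩ := h₁.pi_inv
  obtain ⟨_, _, e, -, hB'⟩ := h₂.pi_inv
  cases e
  exact hB.conv.trans hB'.conv.symm

theorem Conv.pi_congr_cod (A : Tm) {B B' : Tm} (h : Conv B B') :
    Conv (.pi A B) (.pi A B') := by
  obtain ⟨v, h₁, h₂⟩ := h.join
  exact (h₁.map (.piCod A)).conv.trans (h₂.map (.piCod A)).conv.symm

theorem Conv.subst (u : Tm) (k : ℕ) {t t' : Tm} (h : Conv t t') :
    Conv (subst u k t) (subst u k t') := by
  induction h with
  | rel _ _ h => exact ((Par.of_red h).subst (.refl u) k).reds.conv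
  | refl => exact .refl _
  | symm _ _ _ ih => exact ih.symm
  | trans _ _ _ _ _ ih ih' => exact ih.trans ih'

mutual
theorem InferC.conv {Γ : Ctx} {t T T' : Tm} : InferC Γ t T → InferC Γ t T' → Conv T T'
  | .sort, .sort => .refl _
  | .var h, .var h' => by
    cases h.symm.trans h'
    exact .refl _
  | .pi hA hB, .pi hA' hB' => by
    cases hA.eq hA'
    cases hB.eq hB'
    exact .refl _
  | .lam _ ht, .lam _ ht' => (ht.conv ht').pi_congr_cod _
  | .app ht _, .app ht' _ => (ht.conv ht').pi_cod.subst _ 0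

theorem InferSortC.eq {Γ : Ctx} {t T T' : Tm} : InferSortC Γ t T → InferSortC Γ t T' → T = T'
  | .inferSort h hr, .inferSort h' hr' =>
    congrArg Tm.sort (hr.conv.symm.trans ((h.conv h').trans hr'.conv)).sort_inj

theorem InferPiC.conv {Γ : Ctx} {t T T' : Tm} : InferPiC Γ t T → InferPiC Γ t T' → Conv T T'
  | .inferPi h hr, .inferPi h' hr' => hr.conv.symm.trans ((h.conv h').trans hr'.conv)
end

/-- **Uniqueness of inferred types (cumulative system).** If `⊢ Γ`,
`Γ ⊢ t ▹ T` and `Γ ⊢ t ▹ T'`, then `T ≡ T'`. -/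
theorem inferC_unique {Γ : Ctx} {t T T' : Tm} (hΓ : WfCtxC Γ)
    (h : InferC Γ t T) (h' : InferC Γ t T') : Conv T T' :=
  h.conv h'

end CComega
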